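/- arXiv:1905.00712 — 2 statements merged into one kernel-verified Lean document; each statement's English description precedes it below -/
import Mathlib

section
/- For every natural number l ≥ 1 and all real numbers λ, μ, the determinant of M_l(λ,μ) vanishes if and only if (λ − η_l)(μ − ξ_l) = l²(l+2)². Hence the zero set of det M_l in the (μ,λ)-plane is an equilateral hyperbola with horizontal asymptote λ = η_l and vertical asymptote μ = ξ_l. -/
/-- The matrix `M_l(λ,μ)` from Theorem `fundamental-2` of the paper, for the
multi-parameter biharmonic Steklov problems with `σ = 0` on the unit ball of `ℝ^N`. -/
noncomputable def steklovMatrix (N l : ℕ) (lam mu : ℝ) : Matrix (Fin 2) (Fin 2) ℝ :=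
  !![(l : ℝ) * ((l : ℝ) - 1 - lam), ((l : ℝ) + 2) * ((l : ℝ) + 1 - lam);
     (l : ℝ) * ((l : ℝ) + (N : ℝ) - 2) * ((l : ℝ) - 1) - mu,
     (l : ℝ) * ((l : ℝ) * ((l : ℝ) - 5) + (N : ℝ) * ((l : ℝ) - 1) - 2) - mu]

/-- `ξ_l`, the NBS eigenvalue on the unit ball associated with degree `l`. -/
noncomputable def xiBall (N l : ℕ) : ℝ :=
  (l : ℝ) * (2 * (l : ℝ) ^ 2 + ((N : ℝ) - 1) * (l : ℝ) - (N : ℝ) + 2)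

/-- `η_l`, the DBS eigenvalue on the unit ball associated with degree `l`. -/
noncomputable def etaBall (l : ℕ) : ℝ := 2 * (l : ℝ) + 1

/-- `P_l := 3l⁴ + 2(N−2)l³ − (N+1)l² − (N−2)l`. -/
noncomputable def PBall (N l : ℕ) : ℝ :=
  3 * (l : ℝ) ^ 4 + 2 * ((N : ℝ) - 2) * (l : ℝ) ^ 3 - ((N : ℝ) + 1) * (l : ℝ) ^ 2
    - ((N : ℝ) - 2) * (l : ℝ)

/-- The determinant of `M_l(λ,μ)`, with the hyperbola equation factored out. -/
theorem det_steklovMatrix (N l : ℕ) (lam mu : ℝ) :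
    (steklovMatrix N l lam mu).det =
      -2 * ((lam - etaBall l) * (mu - xiBall N l) - (l : ℝ) ^ 2 * ((l : ℝ) + 2) ^ 2) := by
  rw [steklovMatrix, Matrix.det_fin_two_of, etaBall, xiBall]
  ring

/-- For every `l ≥ 1` and all real `λ, μ`, the determinant of `M_l(λ,μ)` vanishes iff
`(λ − η_l)(μ − ξ_l) = l²(l+2)²`; i.e. the zero set of `det M_l` in the `(μ,λ)`-plane is an
equilateral hyperbola with horizontal asymptote `λ = η_l` and vertical asymptote `μ = ξ_l`. -/
theorem det_steklovMatrix_eq_zero_iff_hyperbola (N : ℕ) (hN : 2 ≤ N) (l : ℕ) (hl : 1 ≤ l)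
    (lam mu : ℝ) :
    (steklovMatrix N l lam mu).det = 0 ↔
      (lam - etaBall l) * (mu - xiBall N l) = (l : ℝ) ^ 2 * ((l : ℝ) + 2) ^ 2 := by
  rw [det_steklovMatrix, mul_eq_zero_iff_left (by norm_num), sub_eq_zero]
end

section
/- For every fixed real λ < 1, the sequence of (BS_λ) eigenvalues on the unit ball, μ_j(λ) := ξ_{ℓ(j)} + ℓ(j)²(ℓ(j)+2)² / (λ − η_{ℓ(j)}), satisfies the Weyl-type asymptotic law lim_{j→∞} μ_j(λ) / j^{3/(N−1)} = (3/4) · 2^{(N−4)/(N−1)} ((N−1)!)^{3/(N−1)}. -/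
/-- `D_N(ℓ) = (2ℓ+N−1)(N+ℓ−2)!/(ℓ!(N−1)!)`, the dimension of the space of spherical
harmonics of degree at most `ℓ` in `ℝ^N` (as a real number). -/
noncomputable def harmDim (N l : ℕ) : ℝ :=
  (2 * (l : ℝ) + (N : ℝ) - 1) * (Nat.factorial (N + l - 2) : ℝ) /
    ((Nat.factorial l : ℝ) * (Nat.factorial (N - 1) : ℝ))

/-- `L : ℕ → ℕ` assigns to each index `j ≥ 1` the unique degree `ℓ(j)` with
`D_N(ℓ(j)−1) < j ≤ D_N(ℓ(j))` (with the convention `D_N(−1) = 0`, i.e. all lower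
degrees `m < ℓ(j)` satisfy `D_N(m) < j`). -/
def IsDegreeCount (N : ℕ) (L : ℕ → ℕ) : Prop :=
  ∀ j : ℕ, 1 ≤ j → (j : ℝ) ≤ harmDim N (L j) ∧ ∀ m : ℕ, m < L j → harmDim N m < (j : ℝ)

open Filter Topology

theorem tendsto_natCast_add_div_self (c : ℝ) :
    Tendsto (fun l : ℕ => ((l : ℝ) + c) / l) atTop (𝓝 1) := by
  have h : Tendsto (fun l : ℕ => 1 + c / (l : ℝ)) atTop (𝓝 (1 + 0)) :=
    tendsto_const_nhds.add (tendsto_const_div_atTop_nhds_zero_nat c)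
  rw [add_zero] at h
  refine h.congr' ?_
  filter_upwards [eventually_gt_atTop 0] with l hl
  have hl' : (l : ℝ) ≠ 0 := by positivity
  field_simp

theorem tendsto_factorial_add_div (k : ℕ) :
    Tendsto (fun l : ℕ => ((l + k).factorial : ℝ) / (l.factorial * (l : ℝ) ^ k))
      atTop (𝓝 1) := by
  induction k with
  | zero =>
    refine tendsto_const_nhds.congr fun l => ?_
    have := Nat.factorial_ne_zero l
    simp [this]
  | succ k ih =>
    have h := ih.mul (tendsto_natCast_add_div_self ((k : ℝ) + 1))
    rw [one_mul] at h
    refine h.congr' ?_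
    filter_upwards [eventually_gt_atTop 0] with l hl
    have hl' : (l : ℝ) ≠ 0 := by positivity
    have hf : (l.factorial : ℝ) ≠ 0 := by positivity
    rw [← add_assoc l k 1, Nat.factorial_succ]
    push_cast
    field_simp
    ring

theorem tendsto_harmDim_div_pow (k : ℕ) :
    Tendsto (fun l : ℕ => harmDim (k + 2) l / (l : ℝ) ^ (k + 1)) atTop
      (𝓝 (2 / ((k + 1).factorial : ℝ))) := by
  have h := ((tendsto_natCast_add_div_self (((k : ℝ) + 1) / 2)).mul
    (tendsto_factorial_add_div k)).mul_const (2 / ((k + 1).factorial : ℝ))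
  rw [one_mul, one_mul] at h
  refine h.congr' ?_
  filter_upwards [eventually_gt_atTop 0] with l hl
  have hl' : (l : ℝ) ≠ 0 := by positivity
  have hf : (l.factorial : ℝ) ≠ 0 := by positivity
  have hk : ((k + 1).factorial : ℝ) ≠ 0 := by positivity
  have e1 : k + 2 + l - 2 = l + k := by omega
  have e2 : k + 2 - 1 = k + 1 := by omega
  rw [harmDim, e1, e2]
  push_cast
  field_simp
  ring

theorem tendsto_harmDim_pred_div_pow (k : ℕ) :
    Tendsto (fun l : ℕ => harmDim (k + 2) (l - 1) / (l : ℝ) ^ (k + 1)) atTop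
      (𝓝 (2 / ((k + 1).factorial : ℝ))) := by
  rw [← tendsto_add_atTop_iff_nat 1]
  have h := (tendsto_harmDim_div_pow k).div
    ((tendsto_natCast_add_div_self 1).pow (k + 1)) (by norm_num)
  rw [one_pow, div_one] at h
  refine h.congr' ?_
  filter_upwards [eventually_gt_atTop 0] with l hl
  have hl' : (l : ℝ) ≠ 0 := by positivity
  have hl1 : (l : ℝ) + 1 ≠ 0 := by positivity
  simp only [Pi.div_apply, Nat.add_sub_cancel, div_pow]
  push_cast
  field_simp

theorem harmDim_nonneg (k l : ℕ) : 0 ≤ harmDim (k + 2) l := by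
  rw [harmDim]
  have : (0 : ℝ) ≤ 2 * (l : ℝ) + ((k + 2 : ℕ) : ℝ) - 1 := by
    push_cast
    have : (0 : ℝ) ≤ l := by positivity
    have : (0 : ℝ) ≤ k := by positivity
    linarith
  positivity

theorem IsDegreeCount.tendsto_atTop {k : ℕ} {L : ℕ → ℕ} (hL : IsDegreeCount (k + 2) L) :
    Tendsto L atTop atTop := by
  refine Filter.tendsto_atTop.2 fun m => ?_
  have h := (tendsto_natCast_atTop_atTop (R := ℝ)).eventually_gt_atTop
    (∑ i ∈ Finset.range m, harmDim (k + 2) i)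
  filter_upwards [h, eventually_ge_atTop 1] with j hj hj1
  by_contra! hlt
  have h1 := (hL j hj1).1
  have h2 := Finset.single_le_sum (f := fun i => harmDim (k + 2) i)
    (fun i _ => harmDim_nonneg k i) (Finset.mem_range.2 hlt)
  linarith

theorem IsDegreeCount.tendsto_div_pow {k : ℕ} {L : ℕ → ℕ} (hL : IsDegreeCount (k + 2) L) :
    Tendsto (fun j : ℕ => (j : ℝ) / (L j : ℝ) ^ (k + 1)) atTop
      (𝓝 (2 / ((k + 1).factorial : ℝ))) := by
  have hT := hL.tendsto_atTop
  refine tendsto_of_tendsto_of_tendsto_of_le_of_le'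
    ((tendsto_harmDim_pred_div_pow k).comp hT) ((tendsto_harmDim_div_pow k).comp hT) ?_ ?_
  · filter_upwards [eventually_ge_atTop 1, hT.eventually_gt_atTop 0] with j hj hLj
    have := (hL j hj).2 (L j - 1) (by omega)
    simp only [Function.comp_apply]
    gcongr
  · filter_upwards [eventually_ge_atTop 1] with j hj
    have := (hL j hj).1
    simp only [Function.comp_apply]
    gcongr

theorem tendsto_eigenvalue_div_pow_three (N : ℕ) {lam : ℝ} (hlam : lam < 1) :
    Tendsto (fun l : ℕ =>
        (xiBall N l + (l : ℝ) ^ 2 * ((l : ℝ) + 2) ^ 2 / (lam - etaBall l)) / (l : ℝ) ^ 3)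
      atTop (𝓝 (3 / 2)) := by
  have h0 : Tendsto (fun l : ℕ => ((l : ℝ))⁻¹) atTop (𝓝 0) := tendsto_inv_atTop_nhds_zero_nat
  have h1 : Tendsto (fun l : ℕ => 2 + ((N : ℝ) - 1) * (l : ℝ)⁻¹
      + (2 - (N : ℝ)) * ((l : ℝ)⁻¹) ^ 2
      + (1 + 2 * (l : ℝ)⁻¹) ^ 2 / ((lam - 1) * (l : ℝ)⁻¹ - 2)) atTop
      (𝓝 (2 + ((N : ℝ) - 1) * 0 + (2 - (N : ℝ)) * 0 ^ 2
        + (1 + 2 * 0) ^ 2 / ((lam - 1) * 0 - 2))) :=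
    ((tendsto_const_nhds.add (h0.const_mul _)).add ((h0.pow 2).const_mul _)).add
      (((tendsto_const_nhds.add (h0.const_mul _)).pow 2).div
        ((h0.const_mul _).sub tendsto_const_nhds) (by norm_num))
  norm_num at h1
  refine h1.congr' ?_
  filter_upwards [eventually_gt_atTop 0] with l hl
  have hl' : (0 : ℝ) < l := by positivity
  have hd : lam - (2 * (l : ℝ) + 1) ≠ 0 := by linarith
  have he : (lam - 1) * (l : ℝ)⁻¹ - 2 = (lam - (2 * (l : ℝ) + 1)) / l := by
    field_simp
    ring
  rw [he, xiBall, etaBall]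
  field_simp
  ring

/-- Weyl-type law for the (BS_λ) eigenvalues on the unit ball, for fixed `λ < 1`:
`μ_j(λ) = ξ_{ℓ(j)} + ℓ(j)²(ℓ(j)+2)²/(λ − η_{ℓ(j)})` satisfies
`μ_j(λ) / j^{3/(N−1)} → (3/4)·2^{(N−4)/(N−1)} ((N−1)!)^{3/(N−1)}` as `j → ∞`. -/
theorem BSlam_weyl_asymptotics (N : ℕ) (hN : 2 ≤ N) (L : ℕ → ℕ)
    (hL : IsDegreeCount N L) (lam : ℝ) (hlam : lam < 1) :
    Tendsto (fun j : ℕ =>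
        (xiBall N (L j) +
          (L j : ℝ) ^ 2 * ((L j : ℝ) + 2) ^ 2 / (lam - etaBall (L j))) /
          (j : ℝ) ^ ((3 : ℝ) / ((N : ℝ) - 1)))
      atTop
      (𝓝 ((3 / 4 : ℝ) * (2 : ℝ) ^ (((N : ℝ) - 4) / ((N : ℝ) - 1)) *
        (Nat.factorial (N - 1) : ℝ) ^ ((3 : ℝ) / ((N : ℝ) - 1)))) := by
  obtain ⟨k, rfl⟩ : ∃ k, N = k + 2 := ⟨N - 2, by omega⟩
  have hT := hL.tendsto_atTop
  have hk : (k : ℝ) + 1 ≠ 0 := by positivity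
  have hf : (0 : ℝ) < ((k + 1).factorial : ℝ) := by positivity
  have hN1 : ((k + 2 : ℕ) : ℝ) - 1 = (k : ℝ) + 1 := by push_cast; ring
  have hN4 : (((k + 2 : ℕ) : ℝ) - 4) / ((k : ℝ) + 1) = 1 - 3 / ((k : ℝ) + 1) := by
    push_cast
    field_simp
    ring
  rw [hN1, hN4, show k + 2 - 1 = k + 1 by omega]
  have hden := hL.tendsto_div_pow.rpow_const (p := 3 / ((k : ℝ) + 1)) (Or.inl (by positivity))
  have h := ((tendsto_eigenvalue_div_pow_three (k + 2) hlam).comp hT).div hden (by positivity)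
  have hlim : (3 / 2 : ℝ) / (2 / ((k + 1).factorial : ℝ)) ^ (3 / ((k : ℝ) + 1)) =
      3 / 4 * 2 ^ (1 - 3 / ((k : ℝ) + 1)) *
        ((k + 1).factorial : ℝ) ^ (3 / ((k : ℝ) + 1)) := by
    rw [Real.div_rpow (by norm_num) hf.le, Real.rpow_sub (by norm_num), Real.rpow_one]
    field_simp
    norm_num
  rw [hlim] at h
  refine h.congr' ?_
  filter_upwards [hT.eventually_gt_atTop 0, eventually_gt_atTop 0] with j hLj hj
  have hL0 : (0 : ℝ) < L j := by positivity
  have hpow : ((L j : ℝ) ^ (k + 1)) ^ (3 / ((k : ℝ) + 1)) = (L j : ℝ) ^ 3 := by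
    rw [← Real.rpow_natCast_mul hL0.le, ← Real.rpow_natCast]
    congr 1
    push_cast
    field_simp
  simp only [Pi.div_apply, Function.comp_apply]
  rw [Real.div_rpow (by positivity) (by positivity), hpow,
    div_div_div_cancel_right₀ (by positivity)]
end
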